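/- Let n ≥ 2. Let ρ : ℝⁿ → ℝ be twice continuously differentiable, let Ω : ℝⁿ → ℝⁿ be twice continuously differentiable with |Ω(x)| = 1 for all x, let η : ℝ → ℝ be twice continuously differentiable, and let h : [−1,1] → ℝ be continuous and odd. Define G(x,u) := e^{η(ρ(x))(u·Ω(x))²}/Z(x) with Z(x) := ∫_{S^{n−1}} e^{η(ρ(x))(v·Ω(x))²} dσ(v), ψ(x,u) := h(u·Ω(x))(u − (u·Ω(x))Ω(x)), c_k(x) := ∫_{S^{n−1}} (u·Ω(x))^k h(u·Ω(x))(1 − (u·Ω(x))²) G(x,u) dσ(u) for k = 1, 3, and d₂₀(x) := ∫_{S^{n−1}} (u·Ω(x))² G(x,u) dσ(u). Then, writing η = η(ρ(x)), η′ = η′(ρ(x)), P_{Ω⊥} = Id − Ω⊗Ω, (∇ρ·∇)Ω = Σ_j ∂_{x_j}ρ ∂_{x_j}Ω, at every x: ∫_{S^{n−1}} ∇_x·( ρ(x) G(x,u) ∇_x[ η(ρ(x)) ( (u·Ω(x))² − 1/n ) ] ) ψ(x,u) dσ(u) = (2/(n−1)) ( 2 η′ ρ c₁ + η c₁ + ρ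 η η′ ( 2 c₃ − c₁/n − d₂₀ c₁ ) ) (∇ρ·∇)Ω(x) + (2 η ρ c₁/(n−1)) P_{Ω⊥} Δ_xΩ(x), where the divergence ∇_x· acts on the spatial variable at fixed u and Δ_x is the componentwise spatial Laplacian. -/

import Mathlib

open MeasureTheory Metric
open scoped RealInnerProductSpace

/-- The image of a point of the unit sphere of `ℝⁿ` under a linear isometry. -/
noncomputable def sphereMap {n : ℕ}
    (e : EuclideanSpace ℝ (Fin n) ≃ₗᵢ[ℝ] EuclideanSpace ℝ (Fin n))
    (u : sphere (0 : EuclideanSpace ℝ (Fin n)) 1) :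
    sphere (0 : EuclideanSpace ℝ (Fin n)) 1 :=
  ⟨e u, by
    rw [mem_sphere_zero_iff_norm, e.norm_map]
    exact mem_sphere_zero_iff_norm.mp u.2⟩

/-- A measure on the unit sphere of `ℝⁿ` is rotation invariant if it is invariant under
every linear isometry of `ℝⁿ`. -/
def RotationInvariant {n : ℕ} (σ : Measure (sphere (0 : EuclideanSpace ℝ (Fin n)) 1)) :
    Prop :=
  ∀ e : EuclideanSpace ℝ (Fin n) ≃ₗᵢ[ℝ] EuclideanSpace ℝ (Fin n),
    σ.map (sphereMap e) = σ

/-- The Gibbs density `G_η(u) = e^{η(u·Ω)²}/Z_η` on the unit sphere, with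
`Z_η = ∫ e^{η(v·Ω)²} dσ(v)`. -/
noncomputable def gibbs {n : ℕ} (σ : Measure (sphere (0 : EuclideanSpace ℝ (Fin n)) 1))
    (η : ℝ) (Ω : EuclideanSpace ℝ (Fin n))
    (u : sphere (0 : EuclideanSpace ℝ (Fin n)) 1) : ℝ :=
  Real.exp (η * ⟪(u : EuclideanSpace ℝ (Fin n)), Ω⟫ ^ 2) /
    ∫ v : sphere (0 : EuclideanSpace ℝ (Fin n)) 1,
      Real.exp (η * ⟪(v : EuclideanSpace ℝ (Fin n)), Ω⟫ ^ 2) ∂σ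

/-- Partial derivative `∂_{x_j} f(x)` of a scalar field on `ℝⁿ`. -/
noncomputable def pd {n : ℕ} (j : Fin n) (f : EuclideanSpace ℝ (Fin n) → ℝ)
    (x : EuclideanSpace ℝ (Fin n)) : ℝ :=
  fderiv ℝ f x (EuclideanSpace.single j 1)

/-- Partial derivative `∂_{x_j} f(x)` of a vector field on `ℝⁿ`. -/
noncomputable def pdV {n : ℕ} (j : Fin n)
    (f : EuclideanSpace ℝ (Fin n) → EuclideanSpace ℝ (Fin n))
    (x : EuclideanSpace ℝ (Fin n)) : EuclideanSpace ℝ (Fin n) :=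
  fderiv ℝ f x (EuclideanSpace.single j 1)

/-- The orthogonal projection `P_{Ω⊥} v = v − (v·Ω)Ω` onto `Ω⊥`. -/
noncomputable def projPerp {n : ℕ} (Ω v : EuclideanSpace ℝ (Fin n)) :
    EuclideanSpace ℝ (Fin n) :=
  v - ⟪v, Ω⟫ • Ω

/-- The coefficient `c_k = ∫ (u·Ω)^k h(u·Ω)(1−(u·Ω)²) G_η dσ`. -/
noncomputable def cCoeff {n : ℕ} (σ : Measure (sphere (0 : EuclideanSpace ℝ (Fin n)) 1))
    (h : ℝ → ℝ) (η : ℝ) (Ω : EuclideanSpace ℝ (Fin n)) (k : ℕ) : ℝ :=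
  ∫ u : sphere (0 : EuclideanSpace ℝ (Fin n)) 1,
    ⟪(u : EuclideanSpace ℝ (Fin n)), Ω⟫ ^ k *
      h ⟪(u : EuclideanSpace ℝ (Fin n)), Ω⟫ *
      (1 - ⟪(u : EuclideanSpace ℝ (Fin n)), Ω⟫ ^ 2) * gibbs σ η Ω u ∂σ

/-- The coefficient `d₂₀ = ∫ (u·Ω)² G_η dσ`. -/
noncomputable def dCoeff20 {n : ℕ} (σ : Measure (sphere (0 : EuclideanSpace ℝ (Fin n)) 1))
    (η : ℝ) (Ω : EuclideanSpace ℝ (Fin n)) : ℝ :=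
  ∫ u : sphere (0 : EuclideanSpace ℝ (Fin n)) 1,
    ⟪(u : EuclideanSpace ℝ (Fin n)), Ω⟫ ^ 2 * gibbs σ η Ω u ∂σ

section Helpers

variable {n : ℕ}

theorem sphereMap_coe (e : EuclideanSpace ℝ (Fin n) ≃ₗᵢ[ℝ] EuclideanSpace ℝ (Fin n))
    (u : sphere (0 : EuclideanSpace ℝ (Fin n)) 1) :
    (sphereMap e u : EuclideanSpace ℝ (Fin n)) = e u := rfl

theorem sphereMap_continuous
    (e : EuclideanSpace ℝ (Fin n) ≃ₗᵢ[ℝ] EuclideanSpace ℝ (Fin n)) :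
    Continuous (sphereMap e) :=
  Continuous.subtype_mk (e.continuous.comp continuous_subtype_val) _

theorem sphereMap_measurableEmbedding
    (e : EuclideanSpace ℝ (Fin n) ≃ₗᵢ[ℝ] EuclideanSpace ℝ (Fin n)) :
    MeasurableEmbedding (sphereMap e) := by
  let E : sphere (0 : EuclideanSpace ℝ (Fin n)) 1 ≃ₜ sphere (0 : EuclideanSpace ℝ (Fin n)) 1 :=
    { toFun := sphereMap e
      invFun := sphereMap e.symm
      left_inv := fun u => Subtype.ext (by simp [sphereMap_coe])
      right_inv := fun u => Subtype.ext (by simp [sphereMap_coe])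
      continuous_toFun := sphereMap_continuous e
      continuous_invFun := sphereMap_continuous e.symm }
  exact E.measurableEmbedding

theorem integral_sphereMap {F : Type*} [NormedAddCommGroup F] [NormedSpace ℝ F]
    {σ : Measure (sphere (0 : EuclideanSpace ℝ (Fin n)) 1)} (hinv : RotationInvariant σ)
    (e : EuclideanSpace ℝ (Fin n) ≃ₗᵢ[ℝ] EuclideanSpace ℝ (Fin n))
    (f : sphere (0 : EuclideanSpace ℝ (Fin n)) 1 → F) :
    ∫ u, f (sphereMap e u) ∂σ = ∫ u, f u ∂σ := by
  rw [← (sphereMap_measurableEmbedding e).integral_map f, hinv e]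

theorem integrable_of_cont {F : Type*} [NormedAddCommGroup F]
    (σ : Measure (sphere (0 : EuclideanSpace ℝ (Fin n)) 1)) [IsProbabilityMeasure σ]
    {f : sphere (0 : EuclideanSpace ℝ (Fin n)) 1 → F} (hf : Continuous f) :
    Integrable f σ :=
  hf.integrable_of_hasCompactSupport (HasCompactSupport.of_compactSpace f)

/-- Reflections swapping two vectors of equal norm. -/
theorem exists_isometry_swap (v w : EuclideanSpace ℝ (Fin n)) (hvw : ‖v‖ = ‖w‖) :
    ∃ e : EuclideanSpace ℝ (Fin n) ≃ₗᵢ[ℝ] EuclideanSpace ℝ (Fin n),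
      (∀ u, ⟪e u, w⟫ = ⟪u, v⟫) ∧ ∀ z, ⟪v, z⟫ = 0 → ⟪w, z⟫ = 0 → ∀ u, ⟪e u, z⟫ = ⟪u, z⟫ := by
  refine ⟨(Submodule.span ℝ {v - w})ᗮ.reflection, fun u => ?_, fun z hv hw u => ?_⟩
  · have := LinearIsometryEquiv.inner_map_map (Submodule.span ℝ {v - w})ᗮ.reflection u v
    rwa [Submodule.reflection_sub hvw] at this
  · have : (Submodule.span ℝ {v - w})ᗮ.reflection z = z := by
      apply Submodule.reflection_mem_subspace_eq_self
      rw [Submodule.mem_orthogonal_singleton_iff_inner_right, inner_sub_left, hv, hw, sub_zero]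
    conv_lhs => rw [← this]
    rw [LinearIsometryEquiv.inner_map_map]

theorem inner_projPerp (Ω u v : EuclideanSpace ℝ (Fin n)) :
    ⟪projPerp Ω u, v⟫ = ⟪u, projPerp Ω v⟫ := by
  simp only [projPerp, inner_sub_left, inner_sub_right, real_inner_smul_left,
    real_inner_smul_right]
  rw [real_inner_comm Ω v]
  ring

theorem projPerp_inner_self (Ω v : EuclideanSpace ℝ (Fin n)) (hΩ : ‖Ω‖ = 1) :
    ⟪projPerp Ω v, Ω⟫ = 0 := by
  simp [projPerp, inner_sub_left, real_inner_smul_left, hΩ]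

theorem projPerp_of_perp (Ω v : EuclideanSpace ℝ (Fin n)) (hv : ⟪v, Ω⟫ = 0) :
    projPerp Ω v = v := by
  simp [projPerp, hv]

theorem projPerp_normsq (Ω v : EuclideanSpace ℝ (Fin n)) (hΩ : ‖Ω‖ = 1) :
    ‖projPerp Ω v‖ ^ 2 = ‖v‖ ^ 2 - ⟪v, Ω⟫ ^ 2 := by
  rw [← real_inner_self_eq_norm_sq, inner_projPerp, projPerp_of_perp _ _
    (projPerp_inner_self Ω v hΩ), projPerp, inner_sub_right, real_inner_smul_right,
    real_inner_self_eq_norm_sq]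
  ring

/-- Terms even in the perpendicular component integrate to zero. -/
theorem even_vanish {σ : Measure (sphere (0 : EuclideanSpace ℝ (Fin n)) 1)}
    (hinv : RotationInvariant σ) (Ω : EuclideanSpace ℝ (Fin n)) (hΩ : ‖Ω‖ = 1)
    (A : sphere (0 : EuclideanSpace ℝ (Fin n)) 1 → ℝ)
    (hA : ∀ u v : sphere (0 : EuclideanSpace ℝ (Fin n)) 1,
      ⟪(v : EuclideanSpace ℝ (Fin n)), Ω⟫ = ⟪(u : EuclideanSpace ℝ (Fin n)), Ω⟫ →
      (∀ w : EuclideanSpace ℝ (Fin n), ⟪w, Ω⟫ = 0 →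
        ⟪(v : EuclideanSpace ℝ (Fin n)), w⟫ = -⟪(u : EuclideanSpace ℝ (Fin n)), w⟫) →
      A v = A u) :
    ∫ u, A u • projPerp Ω (u : EuclideanSpace ℝ (Fin n)) ∂σ = 0 := by
  have key : ∀ u : sphere (0 : EuclideanSpace ℝ (Fin n)) 1,
      (sphereMap (Submodule.span ℝ {Ω}).reflection u : EuclideanSpace ℝ (Fin n))
        = (2 * ⟪(u : EuclideanSpace ℝ (Fin n)), Ω⟫) • Ω - u := by
    intro u
    rw [sphereMap_coe, Submodule.reflection_singleton_apply, hΩ, real_inner_comm]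
    simp [two_smul, two_mul, add_smul]
  have h1 := integral_sphereMap hinv (Submodule.span ℝ {Ω}).reflection
    (fun u => A u • projPerp Ω (u : EuclideanSpace ℝ (Fin n)))
  have h2 : ∀ u : sphere (0 : EuclideanSpace ℝ (Fin n)) 1,
      A (sphereMap (Submodule.span ℝ {Ω}).reflection u) •
        projPerp Ω (sphereMap (Submodule.span ℝ {Ω}).reflection u : EuclideanSpace ℝ (Fin n))
      = -(A u • projPerp Ω (u : EuclideanSpace ℝ (Fin n))) := by
    intro u
    have hs : ⟪(2 * ⟪(u : EuclideanSpace ℝ (Fin n)), Ω⟫) • Ω - (u : EuclideanSpace ℝ (Fin n)), Ω⟫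
        = ⟪(u : EuclideanSpace ℝ (Fin n)), Ω⟫ := by
      rw [inner_sub_left, real_inner_smul_left, real_inner_self_eq_norm_sq, hΩ]; ring
    rw [hA u]
    · rw [key, projPerp, hs, projPerp, ← smul_neg]
      congr 1
      module
    · rw [key, hs]
    · intro w hw
      rw [key, inner_sub_left, real_inner_smul_left, real_inner_comm w Ω, hw]; ring
  simp only [h2, integral_neg] at h1
  have h3 : (2 : ℝ) • ∫ u, A u • projPerp Ω (u : EuclideanSpace ℝ (Fin n)) ∂σ = 0 := by
    rw [two_smul]
    nth_rewrite 1 [← h1]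
    simp
  exact (smul_eq_zero.mp h3).resolve_left two_ne_zero

/-- The quadratic form is isotropic on `Ω⊥`. -/
theorem quad_iso {σ : Measure (sphere (0 : EuclideanSpace ℝ (Fin n)) 1)}
    [IsProbabilityMeasure σ]
    (hinv : RotationInvariant σ) (Ω : EuclideanSpace ℝ (Fin n)) (hΩ : ‖Ω‖ = 1)
    (g : ℝ → ℝ)
    (w wb : EuclideanSpace ℝ (Fin n)) (hw : ⟪w, Ω⟫ = 0) (hwb : ⟪wb, Ω⟫ = 0) :
    (∫ u : sphere (0 : EuclideanSpace ℝ (Fin n)) 1, g ⟪(u : EuclideanSpace ℝ (Fin n)), Ω⟫ *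
      ⟪(u : EuclideanSpace ℝ (Fin n)), w⟫ ^ 2 ∂σ) * ‖wb‖ ^ 2 =
    (∫ u : sphere (0 : EuclideanSpace ℝ (Fin n)) 1, g ⟪(u : EuclideanSpace ℝ (Fin n)), Ω⟫ *
      ⟪(u : EuclideanSpace ℝ (Fin n)), wb⟫ ^ 2 ∂σ) * ‖w‖ ^ 2 := by
  obtain ⟨e, he, hz⟩ := exists_isometry_swap (‖wb‖ • w) (‖w‖ • wb)
    (by rw [norm_smul, norm_smul]; simp [mul_comm])
  have hzΩ := hz Ω (by rw [real_inner_smul_left, hw, mul_zero])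
    (by rw [real_inner_smul_left, hwb, mul_zero])
  have h1 := integral_sphereMap hinv e
    (fun u => g ⟪(u : EuclideanSpace ℝ (Fin n)), Ω⟫ *
      ⟪(u : EuclideanSpace ℝ (Fin n)), ‖w‖ • wb⟫ ^ 2)
  simp only [sphereMap_coe, he, hzΩ, real_inner_smul_right, mul_pow] at h1
  rw [← integral_mul_const, ← integral_mul_const]
  refine Eq.trans (integral_congr_ae (Filter.Eventually.of_forall fun u => ?_))
    (h1.trans (integral_congr_ae (Filter.Eventually.of_forall fun u => ?_)))
  · simp only []
    ring
  · simp only []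
    ring

theorem quad_val (hn : 2 ≤ n) {σ : Measure (sphere (0 : EuclideanSpace ℝ (Fin n)) 1)}
    [IsProbabilityMeasure σ]
    (hinv : RotationInvariant σ) (Ω : EuclideanSpace ℝ (Fin n)) (hΩ : ‖Ω‖ = 1)
    (g : ℝ → ℝ)
    (hg : Continuous fun u : sphere (0 : EuclideanSpace ℝ (Fin n)) 1 =>
      g ⟪(u : EuclideanSpace ℝ (Fin n)), Ω⟫)
    (w : EuclideanSpace ℝ (Fin n)) (hw : ⟪w, Ω⟫ = 0) :
    ∫ u : sphere (0 : EuclideanSpace ℝ (Fin n)) 1, g ⟪(u : EuclideanSpace ℝ (Fin n)), Ω⟫ *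
      ⟪(u : EuclideanSpace ℝ (Fin n)), w⟫ ^ 2 ∂σ =
    (∫ u : sphere (0 : EuclideanSpace ℝ (Fin n)) 1, g ⟪(u : EuclideanSpace ℝ (Fin n)), Ω⟫ *
      (1 - ⟪(u : EuclideanSpace ℝ (Fin n)), Ω⟫ ^ 2) ∂σ) / ((n : ℝ) - 1) * ‖w‖ ^ 2 := by
  have hn1 : (n : ℝ) - 1 ≠ 0 := by
    have : (2 : ℝ) ≤ n := by exact_mod_cast hn
    linarith
  let b := EuclideanSpace.basisFun (Fin n) ℝ
  have hsum := Finset.sum_congr rfl (fun j (_ : j ∈ Finset.univ) =>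
    quad_iso hinv Ω hΩ g w (projPerp Ω (b j)) hw (projPerp_inner_self Ω (b j) hΩ))
  rw [← Finset.mul_sum, ← Finset.sum_mul, ← integral_finsetSum] at hsum
  · have e1 : ∑ j, ‖projPerp Ω (b j)‖ ^ 2 = (n : ℝ) - 1 := by
      simp only [projPerp_normsq _ _ hΩ, Finset.sum_sub_distrib]
      congr 1
      · simp
      · have := b.sum_sq_norm_inner_right Ω
        simpa [hΩ] using this
    have e2 : ∀ u : sphere (0 : EuclideanSpace ℝ (Fin n)) 1,
        ∑ j, g ⟪(u : EuclideanSpace ℝ (Fin n)), Ω⟫ *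
          ⟪(u : EuclideanSpace ℝ (Fin n)), projPerp Ω (b j)⟫ ^ 2
        = g ⟪(u : EuclideanSpace ℝ (Fin n)), Ω⟫ *
          (1 - ⟪(u : EuclideanSpace ℝ (Fin n)), Ω⟫ ^ 2) := by
      intro u
      rw [← Finset.mul_sum]
      congr 1
      have hu : ‖(u : EuclideanSpace ℝ (Fin n))‖ = 1 := mem_sphere_zero_iff_norm.mp u.2
      have h3 := b.sum_sq_norm_inner_left (projPerp Ω (u : EuclideanSpace ℝ (Fin n)))
      rw [projPerp_normsq _ _ hΩ, hu, one_pow] at h3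
      rw [← h3]
      refine Finset.sum_congr rfl fun j _ => ?_
      rw [← inner_projPerp, Real.norm_eq_abs, sq_abs]
    simp only [e2] at hsum
    rw [e1] at hsum
    field_simp
    linarith
  · intro j _
    exact integrable_of_cont σ (hg.mul (by fun_prop))

theorem odd_val (hn : 2 ≤ n) {σ : Measure (sphere (0 : EuclideanSpace ℝ (Fin n)) 1)}
    [IsProbabilityMeasure σ]
    (hinv : RotationInvariant σ) (Ω : EuclideanSpace ℝ (Fin n)) (hΩ : ‖Ω‖ = 1)
    (g : ℝ → ℝ)
    (hg : Continuous fun u : sphere (0 : EuclideanSpace ℝ (Fin n)) 1 =>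
      g ⟪(u : EuclideanSpace ℝ (Fin n)), Ω⟫)
    (w : EuclideanSpace ℝ (Fin n)) (hw : ⟪w, Ω⟫ = 0) :
    ∫ u : sphere (0 : EuclideanSpace ℝ (Fin n)) 1, (g ⟪(u : EuclideanSpace ℝ (Fin n)), Ω⟫ *
      ⟪(u : EuclideanSpace ℝ (Fin n)), w⟫) • projPerp Ω (u : EuclideanSpace ℝ (Fin n)) ∂σ =
    ((∫ u : sphere (0 : EuclideanSpace ℝ (Fin n)) 1, g ⟪(u : EuclideanSpace ℝ (Fin n)), Ω⟫ *
      (1 - ⟪(u : EuclideanSpace ℝ (Fin n)), Ω⟫ ^ 2) ∂σ) / ((n : ℝ) - 1)) • w := by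
  have hP : Continuous fun u : sphere (0 : EuclideanSpace ℝ (Fin n)) 1 =>
      projPerp Ω (u : EuclideanSpace ℝ (Fin n)) := by
    unfold projPerp; fun_prop
  refine ext_inner_left ℝ fun v => ?_
  have hI : Integrable (fun u : sphere (0 : EuclideanSpace ℝ (Fin n)) 1 =>
      (g ⟪(u : EuclideanSpace ℝ (Fin n)), Ω⟫ *
      ⟪(u : EuclideanSpace ℝ (Fin n)), w⟫) • projPerp Ω (u : EuclideanSpace ℝ (Fin n))) σ :=
    integrable_of_cont σ ((hg.mul (by fun_prop)).smul hP)
  rw [← integral_inner hI, real_inner_smul_right]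
  have hv := projPerp_inner_self Ω v hΩ
  have e1 := quad_val hn hinv Ω hΩ g hg (w + projPerp Ω v)
    (by rw [inner_add_left, hw, hv, add_zero])
  have e2 := quad_val hn hinv Ω hΩ g hg (w - projPerp Ω v)
    (by rw [inner_sub_left, hw, hv, sub_zero])
  have e3 : ⟪v, w⟫ = (‖w + projPerp Ω v‖ ^ 2 - ‖w - projPerp Ω v‖ ^ 2) / 4 := by
    rw [norm_add_sq_real, norm_sub_sq_real, ← inner_projPerp, projPerp_of_perp _ _ hw,
      real_inner_comm]
    ring
  rw [e3, mul_div_assoc', mul_sub, ← e1, ← e2, ← integral_sub, ← integral_div]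
  · refine integral_congr_ae (Filter.Eventually.of_forall fun u => ?_)
    simp only [inner_add_right, inner_sub_right, real_inner_smul_right]
    rw [← inner_projPerp Ω _ v, real_inner_comm v]
    ring
  · exact integrable_of_cont σ (hg.mul (by fun_prop))
  · exact integrable_of_cont σ (hg.mul (by fun_prop))

/-- Differentiability together with the value of a partial derivative. -/
def HP (j : Fin n) (f : EuclideanSpace ℝ (Fin n) → ℝ) (d : ℝ)
    (x : EuclideanSpace ℝ (Fin n)) : Prop :=
  DifferentiableAt ℝ f x ∧ pd j f x = d

theorem HP.mul {j : Fin n} {f g : EuclideanSpace ℝ (Fin n) → ℝ} {a b : ℝ}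
    {x : EuclideanSpace ℝ (Fin n)} (hf : HP j f a x) (hg : HP j g b x) :
    HP j (fun y => f y * g y) (a * g x + f x * b) x := by
  obtain ⟨hf, rfl⟩ := hf
  obtain ⟨hg, rfl⟩ := hg
  refine ⟨hf.mul hg, ?_⟩
  simp only [pd]
  rw [fderiv_fun_mul hf hg]
  simp
  ring

theorem HP.add {j : Fin n} {f g : EuclideanSpace ℝ (Fin n) → ℝ} {a b : ℝ}
    {x : EuclideanSpace ℝ (Fin n)} (hf : HP j f a x) (hg : HP j g b x) :
    HP j (fun y => f y + g y) (a + b) x := by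
  obtain ⟨hf, rfl⟩ := hf
  obtain ⟨hg, rfl⟩ := hg
  refine ⟨hf.add hg, ?_⟩
  simp only [pd]
  rw [fderiv_fun_add hf hg]
  simp

theorem HP.comp {j : Fin n} {f : EuclideanSpace ℝ (Fin n) → ℝ} {φ : ℝ → ℝ} {a b : ℝ}
    {x : EuclideanSpace ℝ (Fin n)} (hf : HP j f a x) (hφ : HasDerivAt φ b (f x)) :
    HP j (fun y => φ (f y)) (b * a) x := by
  obtain ⟨hf, rfl⟩ := hf
  have := hφ.comp_hasFDerivAt x hf.hasFDerivAt
  refine ⟨this.differentiableAt, ?_⟩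
  change fderiv ℝ (φ ∘ f) x _ = _
  rw [this.fderiv]
  simp [pd]

theorem HP.of_diff (j : Fin n) {f : EuclideanSpace ℝ (Fin n) → ℝ}
    {x : EuclideanSpace ℝ (Fin n)} (hf : DifferentiableAt ℝ f x) : HP j f (pd j f x) x :=
  ⟨hf, rfl⟩

theorem HP.inner_left (j : Fin n) {V : EuclideanSpace ℝ (Fin n) → EuclideanSpace ℝ (Fin n)}
    {x : EuclideanSpace ℝ (Fin n)} (hV : DifferentiableAt ℝ V x)
    (u : EuclideanSpace ℝ (Fin n)) :
    HP j (fun y => ⟪u, V y⟫) ⟪u, pdV j V x⟫ x := by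
  have := (innerSL ℝ u).hasFDerivAt.comp x hV.hasFDerivAt
  refine ⟨this.differentiableAt, ?_⟩
  change fderiv ℝ ((innerSL ℝ u) ∘ V) x _ = _
  rw [this.fderiv]
  simp [pdV]

theorem pd_differentiable {ρ : EuclideanSpace ℝ (Fin n) → ℝ} (hρ : ContDiff ℝ 2 ρ) (j : Fin n) :
    Differentiable ℝ (pd j ρ) := by
  have : ContDiff ℝ 1 (fderiv ℝ ρ) := hρ.fderiv_right (by norm_num)
  have h2 := this.differentiable (by norm_num)
  unfold pd
  fun_prop

theorem pdV_differentiable {V : EuclideanSpace ℝ (Fin n) → EuclideanSpace ℝ (Fin n)}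
    (hV : ContDiff ℝ 2 V) (j : Fin n) :
    Differentiable ℝ (pdV j V) := by
  have : ContDiff ℝ 1 (fderiv ℝ V) := hV.fderiv_right (by norm_num)
  have h2 := this.differentiable (by norm_num)
  unfold pdV
  fun_prop

/-- The partition function. -/
noncomputable def Zf (σ : Measure (sphere (0 : EuclideanSpace ℝ (Fin n)) 1))
    (Ω : EuclideanSpace ℝ (Fin n)) (t : ℝ) : ℝ :=
  ∫ v : sphere (0 : EuclideanSpace ℝ (Fin n)) 1,
      Real.exp (t * ⟪(v : EuclideanSpace ℝ (Fin n)), Ω⟫ ^ 2) ∂σ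

theorem Zf_eq {σ : Measure (sphere (0 : EuclideanSpace ℝ (Fin n)) 1)}
    (hinv : RotationInvariant σ) (Ω Ωb : EuclideanSpace ℝ (Fin n)) (h : ‖Ω‖ = ‖Ωb‖) (t : ℝ) :
    Zf σ Ω t = Zf σ Ωb t := by
  obtain ⟨e, he, -⟩ := exists_isometry_swap Ω Ωb h
  have := integral_sphereMap hinv e
    (fun v => Real.exp (t * ⟪(v : EuclideanSpace ℝ (Fin n)), Ωb⟫ ^ 2))
  simp only [sphereMap_coe, he] at this
  exact this

theorem Zf_pos (σ : Measure (sphere (0 : EuclideanSpace ℝ (Fin n)) 1)) [IsProbabilityMeasure σ]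
    (Ω : EuclideanSpace ℝ (Fin n)) (t : ℝ) : 0 < Zf σ Ω t :=
  integral_exp_pos (integrable_of_cont σ (by fun_prop))

theorem Zf_deriv (σ : Measure (sphere (0 : EuclideanSpace ℝ (Fin n)) 1)) [IsProbabilityMeasure σ]
    (Ω : EuclideanSpace ℝ (Fin n)) (t : ℝ) :
    HasDerivAt (Zf σ Ω) (dCoeff20 σ t Ω * Zf σ Ω t) t := by
  have h1 := ProbabilityTheory.hasDerivAt_mgf (μ := σ)
    (X := fun v : sphere (0 : EuclideanSpace ℝ (Fin n)) 1 =>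
      ⟪(v : EuclideanSpace ℝ (Fin n)), Ω⟫ ^ 2) (t := t) (by
      have : ProbabilityTheory.integrableExpSet
          (fun v : sphere (0 : EuclideanSpace ℝ (Fin n)) 1 =>
            ⟪(v : EuclideanSpace ℝ (Fin n)), Ω⟫ ^ 2) σ = Set.univ := by
        ext s
        simp only [Set.mem_univ, iff_true]
        exact integrable_of_cont σ (by fun_prop)
      rw [this]; simp)
  have h2 : dCoeff20 σ t Ω * Zf σ Ω t = ∫ v : sphere (0 : EuclideanSpace ℝ (Fin n)) 1,
      ⟪(v : EuclideanSpace ℝ (Fin n)), Ω⟫ ^ 2 *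
        Real.exp (t * ⟪(v : EuclideanSpace ℝ (Fin n)), Ω⟫ ^ 2) ∂σ := by
    rw [dCoeff20, ← integral_mul_const]
    refine integral_congr_ae (Filter.Eventually.of_forall fun u => ?_)
    have := (Zf_pos σ Ω t).ne'
    change _ * (_ / Zf σ Ω t) * _ = _
    field_simp
  rw [h2]
  exact h1

theorem div_term {σ : Measure (sphere (0 : EuclideanSpace ℝ (Fin n)) 1)}
    [IsProbabilityMeasure σ] (hinv : RotationInvariant σ)
    {ρ : EuclideanSpace ℝ (Fin n) → ℝ} (hρ : ContDiff ℝ 2 ρ)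
    {Ω : EuclideanSpace ℝ (Fin n) → EuclideanSpace ℝ (Fin n)} (hΩdiff : ContDiff ℝ 2 Ω)
    (hΩ : ∀ x, ‖Ω x‖ = 1)
    {η : ℝ → ℝ} (hη : ContDiff ℝ 2 η) (x : EuclideanSpace ℝ (Fin n))
    (u : sphere (0 : EuclideanSpace ℝ (Fin n)) 1) (j : Fin n)
    (s q q2 R R2 G e e1 e2 d : ℝ)
    (hs : s = ⟪(u : EuclideanSpace ℝ (Fin n)), Ω x⟫)
    (hq : q = ⟪(u : EuclideanSpace ℝ (Fin n)), pdV j Ω x⟫)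
    (hq2 : q2 = ⟪(u : EuclideanSpace ℝ (Fin n)), pdV j (fun y => pdV j Ω y) x⟫)
    (hR : R = pd j ρ x) (hR2 : R2 = pd j (fun y => pd j ρ y) x)
    (hG : G = gibbs σ (η (ρ x)) (Ω x) u) (he : e = η (ρ x)) (he1 : e1 = deriv η (ρ x))
    (he2 : e2 = deriv (deriv η) (ρ x)) (hd : d = dCoeff20 σ (η (ρ x)) (Ω x)) :
    pd j (fun y => ρ y * gibbs σ (η (ρ y)) (Ω y) u *
                pd j (fun z => η (ρ z) *
                  (⟪(u : EuclideanSpace ℝ (Fin n)), Ω z⟫ ^ 2 - 1 / n)) y) x =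
      G * (R * (e1 * R * (s ^ 2 - 1 / n) + 2 * e * s * q)
        + ρ x * (e1 * R * s ^ 2 + 2 * e * s * q - e1 * R * d) *
          (e1 * R * (s ^ 2 - 1 / n) + 2 * e * s * q)
        + ρ x * ((e2 * R * R + e1 * R2) * (s ^ 2 - 1 / n) + 4 * e1 * R * s * q
          + 2 * e * q ^ 2 + 2 * e * s * q2)) := by
  have hρd : Differentiable ℝ ρ := hρ.differentiable (by norm_num)
  have hΩd : Differentiable ℝ Ω := hΩdiff.differentiable (by norm_num)
  have hηd : Differentiable ℝ η := hη.differentiable (by norm_num)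
  have hη1 : Differentiable ℝ (deriv η) := by
    have : ContDiff ℝ 1 (deriv η) := ContDiff.iterate_deriv' 1 1 hη
    exact this.differentiable (by norm_num)
  have pρ : ∀ y, HP j ρ (pd j ρ y) y := fun y => HP.of_diff j (hρd y)
  have pe : ∀ y, HP j (fun y => η (ρ y)) (deriv η (ρ y) * pd j ρ y) y := fun y =>
    (pρ y).comp (hηd _).hasDerivAt
  have ps : ∀ y, HP j (fun y => ⟪(u : EuclideanSpace ℝ (Fin n)), Ω y⟫)
      ⟪(u : EuclideanSpace ℝ (Fin n)), pdV j Ω y⟫ y := fun y => HP.inner_left j (hΩd y) _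
  have hsq : ∀ t : ℝ, HasDerivAt (fun t : ℝ => t ^ 2 - 1 / (n : ℝ)) (2 * t) t := fun t => by
    simpa using (hasDerivAt_pow 2 t).sub_const (1 / (n : ℝ))
  have hsq0 : ∀ t : ℝ, HasDerivAt (fun t : ℝ => t ^ 2) (2 * t) t := fun t => by
    simpa using (hasDerivAt_pow 2 t)
  have h2t : ∀ t : ℝ, HasDerivAt (fun t : ℝ => 2 * t) 2 t := fun t => by
    simpa using (hasDerivAt_id t).const_mul 2
  have pF := fun y => (pe y).mul ((ps y).comp (hsq _))
  have hF : (fun y => pd j (fun z => η (ρ z) *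
                  (⟪(u : EuclideanSpace ℝ (Fin n)), Ω z⟫ ^ 2 - 1 / n)) y) = _ :=
    funext fun y => (pF y).2
  have hFy := fun y => congrFun hF y
  have hgy : ∀ y, gibbs σ (η (ρ y)) (Ω y) u =
      Real.exp (η (ρ y) * ⟪(u : EuclideanSpace ℝ (Fin n)), Ω y⟫ ^ 2) *
        (Zf σ (Ω x) (η (ρ y)))⁻¹ := by
    intro y
    rw [Zf_eq hinv (Ω x) (Ω y) (by rw [hΩ, hΩ]), gibbs, div_eq_mul_inv, Zf]
  have pG := (((pe x).mul ((ps x).comp (hsq0 _))).comp (Real.hasDerivAt_exp _)).mul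
    ((pe x).comp ((Zf_deriv σ (Ω x) _).inv (Zf_pos σ (Ω x) _).ne'))
  have p2 := (((pρ x).comp (hη1 _).hasDerivAt).mul (HP.of_diff j (pd_differentiable hρ j x))).mul
    ((ps x).comp (hsq _))
  have p3 := (pe x).mul (((ps x).comp (h2t _)).mul
    (HP.inner_left j (pdV_differentiable hΩdiff j x) (u : EuclideanSpace ℝ (Fin n))))
  have pT := ((pρ x).mul pG).mul (p2.add p3)
  simp only [hFy, hgy]
  refine pT.2.trans ?_
  have hZ := (Zf_pos σ (Ω x) (η (ρ x))).ne'
  rw [hgy x] at hG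
  subst hG hs hq hq2 hR hR2 he he1 he2 hd
  simp only [Pi.inv_apply]
  field_simp
  ring

theorem perp_deriv {Ω : EuclideanSpace ℝ (Fin n) → EuclideanSpace ℝ (Fin n)}
    (hΩdiff : ContDiff ℝ 2 Ω) (hΩ : ∀ x, ‖Ω x‖ = 1) (j : Fin n)
    (x : EuclideanSpace ℝ (Fin n)) : ⟪pdV j Ω x, Ω x⟫ = 0 := by
  have hΩd : DifferentiableAt ℝ Ω x := hΩdiff.differentiable (by norm_num) x
  have h1 := fderiv_inner_apply ℝ hΩd hΩd (EuclideanSpace.single j 1)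
  have h2 : (fun t => ⟪Ω t, Ω t⟫) = fun _ => (1 : ℝ) := by
    funext t; rw [real_inner_self_eq_norm_sq, hΩ]; norm_num
  rw [h2] at h1
  simp only [fderiv_fun_const] at h1
  rw [real_inner_comm] at h1
  unfold pdV
  simp at h1
  linarith

end Helpers

/-- The term `I₂ = ∫ ∇_x·( ρ G_{η(ρ)A_Ω} ∇_x(η(ρ)((u·Ω)² − 1/n)) ) ψ dσ
= (2/(n−1)) (2η′ρc₁₂ + ηc₁₂ + ρηη′(2c₃₂ − c₁₂/n − d₂₀c₁₂)) (∇_xρ·∇_x)Ω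
+ (2ηρc₁₂/(n−1)) P_{Ω⊥}Δ_xΩ`, where `ψ = h(u·Ω) P_{Ω⊥}u` is the Generalized
Collision Invariant with `h` odd. -/
theorem divergence_I2 (n : ℕ) (hn : 2 ≤ n)
    (σ : Measure (sphere (0 : EuclideanSpace ℝ (Fin n)) 1))
    (hprob : IsProbabilityMeasure σ) (hinv : RotationInvariant σ)
    (ρ : EuclideanSpace ℝ (Fin n) → ℝ) (hρ : ContDiff ℝ 2 ρ)
    (Ω : EuclideanSpace ℝ (Fin n) → EuclideanSpace ℝ (Fin n)) (hΩdiff : ContDiff ℝ 2 Ω)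
    (hΩ : ∀ x, ‖Ω x‖ = 1)
    (η : ℝ → ℝ) (hη : ContDiff ℝ 2 η)
    (h : ℝ → ℝ) (hcont : ContinuousOn h (Set.Icc (-1) 1))
    (hodd : ∀ r ∈ Set.Icc (-1 : ℝ) 1, h (-r) = -h r) :
    ∀ x : EuclideanSpace ℝ (Fin n),
      (∫ u : sphere (0 : EuclideanSpace ℝ (Fin n)) 1,
          (∑ j : Fin n,
              pd j (fun y => ρ y * gibbs σ (η (ρ y)) (Ω y) u *
                pd j (fun z => η (ρ z) *
                  (⟪(u : EuclideanSpace ℝ (Fin n)), Ω z⟫ ^ 2 - 1 / n)) y) x) •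
            (h ⟪(u : EuclideanSpace ℝ (Fin n)), Ω x⟫ •
              projPerp (Ω x) (u : EuclideanSpace ℝ (Fin n))) ∂σ)
        = ((2 / ((n : ℝ) - 1)) *
            (2 * deriv η (ρ x) * ρ x * cCoeff σ h (η (ρ x)) (Ω x) 1
              + η (ρ x) * cCoeff σ h (η (ρ x)) (Ω x) 1
              + ρ x * η (ρ x) * deriv η (ρ x) *
                (2 * cCoeff σ h (η (ρ x)) (Ω x) 3
                  - cCoeff σ h (η (ρ x)) (Ω x) 1 / n
                  - dCoeff20 σ (η (ρ x)) (Ω x) * cCoeff σ h (η (ρ x)) (Ω x) 1))) •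
            (∑ j : Fin n, pd j ρ x • pdV j Ω x)
          + ((2 * η (ρ x) * ρ x * cCoeff σ h (η (ρ x)) (Ω x) 1) / ((n : ℝ) - 1)) •
            projPerp (Ω x) (∑ j : Fin n, pdV j (fun y => pdV j Ω y) x) := by
  intro x
  have hn1 : (n : ℝ) - 1 ≠ 0 := by
    have : (2 : ℝ) ≤ n := by exact_mod_cast hn
    linarith
  -- abbreviations
  obtain ⟨e, he⟩ : ∃ e, e = η (ρ x) := ⟨_, rfl⟩
  obtain ⟨e1, he1⟩ : ∃ e, e = deriv η (ρ x) := ⟨_, rfl⟩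
  obtain ⟨e2, he2⟩ : ∃ e, e = deriv (deriv η) (ρ x) := ⟨_, rfl⟩
  obtain ⟨d, hd⟩ : ∃ d, d = dCoeff20 σ (η (ρ x)) (Ω x) := ⟨_, rfl⟩
  obtain ⟨r, hr⟩ : ∃ r, r = ρ x := ⟨_, rfl⟩
  obtain ⟨R, hR⟩ : ∃ R : Fin n → ℝ, ∀ j, R j = pd j ρ x := ⟨_, fun j => rfl⟩
  obtain ⟨R2, hR2⟩ : ∃ R : Fin n → ℝ, ∀ j, R j = pd j (fun y => pd j ρ y) x :=
    ⟨_, fun j => rfl⟩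
  obtain ⟨o, ho⟩ : ∃ o : Fin n → EuclideanSpace ℝ (Fin n), ∀ j, o j = pdV j Ω x :=
    ⟨_, fun j => rfl⟩
  obtain ⟨o2, ho2⟩ : ∃ o : Fin n → EuclideanSpace ℝ (Fin n),
      ∀ j, o j = pdV j (fun y => pdV j Ω y) x := ⟨_, fun j => rfl⟩
  obtain ⟨w, hw⟩ : ∃ w, w = Ω x := ⟨_, rfl⟩
  have hw1 : ‖w‖ = 1 := hw ▸ hΩ x
  have how : ∀ j, ⟪o j, w⟫ = 0 := fun j => by
    rw [ho, hw]; exact perp_deriv hΩdiff hΩ j x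
  obtain ⟨γ, hγ⟩ : ∃ γ : ℝ → ℝ, γ = fun t => Real.exp (e * t ^ 2) / Zf σ w e := ⟨_, rfl⟩
  have hγG : ∀ u : sphere (0 : EuclideanSpace ℝ (Fin n)) 1,
      gibbs σ e w u = γ ⟪(u : EuclideanSpace ℝ (Fin n)), w⟫ := fun u => by rw [hγ]; rfl
  have hγc : Continuous γ := by rw [hγ]; fun_prop
  have hhc : Continuous fun u : sphere (0 : EuclideanSpace ℝ (Fin n)) 1 =>
      h ⟪(u : EuclideanSpace ℝ (Fin n)), w⟫ := by
    refine hcont.comp_continuous (by fun_prop) fun u => ?_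
    have hu : ‖(u : EuclideanSpace ℝ (Fin n))‖ = 1 := mem_sphere_zero_iff_norm.mp u.2
    have := abs_real_inner_le_norm (u : EuclideanSpace ℝ (Fin n)) w
    rw [hu, hw1, one_mul] at this
    exact abs_le.mp this
  have hPc : Continuous fun u : sphere (0 : EuclideanSpace ℝ (Fin n)) 1 =>
      projPerp w (u : EuclideanSpace ℝ (Fin n)) := by
    unfold projPerp; fun_prop
  simp only [← hd]
  simp only [← he, ← he1]
  simp only [← hr, ← hR, ← ho, ← ho2, ← hw]
  -- the three pieces
  obtain ⟨W, hW⟩ : ∃ W, W = ∑ j, R j • o j := ⟨_, rfl⟩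
  obtain ⟨L, hL⟩ : ∃ L, L = ∑ j, o2 j := ⟨_, rfl⟩
  have hWw : ⟪W, w⟫ = 0 := by
    rw [hW, sum_inner]
    exact Finset.sum_eq_zero fun j _ => by rw [real_inner_smul_left, how, mul_zero]
  rw [← hW, ← hL]
  obtain ⟨A, hA⟩ : ∃ A : sphere (0 : EuclideanSpace ℝ (Fin n)) 1 → ℝ, A =
    fun u : sphere (0 : EuclideanSpace ℝ (Fin n)) 1 =>
    h ⟪(u : EuclideanSpace ℝ (Fin n)), w⟫ * γ ⟪(u : EuclideanSpace ℝ (Fin n)), w⟫ *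
    (∑ j, (R j * (e1 * R j * (⟪(u : EuclideanSpace ℝ (Fin n)), w⟫ ^ 2 - 1 / n))
        + r * (e1 * R j * ⟪(u : EuclideanSpace ℝ (Fin n)), w⟫ ^ 2 - e1 * R j * d) *
          (e1 * R j * (⟪(u : EuclideanSpace ℝ (Fin n)), w⟫ ^ 2 - 1 / n))
        + 4 * r * e ^ 2 * ⟪(u : EuclideanSpace ℝ (Fin n)), w⟫ ^ 2 *
          ⟪(u : EuclideanSpace ℝ (Fin n)), o j⟫ ^ 2
        + r * ((e2 * R j * R j + e1 * R2 j) * (⟪(u : EuclideanSpace ℝ (Fin n)), w⟫ ^ 2 - 1 / n)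
          + 2 * e * ⟪(u : EuclideanSpace ℝ (Fin n)), o j⟫ ^ 2
          + 2 * e * ⟪(u : EuclideanSpace ℝ (Fin n)), w⟫ ^ 2 * ⟪o2 j, w⟫))) := ⟨_, rfl⟩
  obtain ⟨g1, hg1⟩ : ∃ g : ℝ → ℝ, g = fun t =>
    2 * (2 * e1 * r + e + r * e * e1 * (2 * t ^ 2 - 1 / n - d)) * t * (h t * γ t) := ⟨_, rfl⟩
  obtain ⟨g2, hg2⟩ : ∃ g : ℝ → ℝ, g = fun t => 2 * e * r * t * (h t * γ t) := ⟨_, rfl⟩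
  have hAc : Continuous A := by
    rw [hA]
    refine (hhc.mul (by fun_prop)).mul (by fun_prop)
  have hg1c : Continuous fun u : sphere (0 : EuclideanSpace ℝ (Fin n)) 1 =>
      g1 ⟪(u : EuclideanSpace ℝ (Fin n)), w⟫ := by
    rw [hg1]
    refine Continuous.mul (by fun_prop) (hhc.mul (by fun_prop))
  have hg2c : Continuous fun u : sphere (0 : EuclideanSpace ℝ (Fin n)) 1 =>
      g2 ⟪(u : EuclideanSpace ℝ (Fin n)), w⟫ := by
    rw [hg2]
    refine Continuous.mul (by fun_prop) (hhc.mul (by fun_prop))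
  have hpt : ∀ u : sphere (0 : EuclideanSpace ℝ (Fin n)) 1,
      (∑ j : Fin n,
              pd j (fun y => ρ y * gibbs σ (η (ρ y)) (Ω y) u *
                pd j (fun z => η (ρ z) *
                  (⟪(u : EuclideanSpace ℝ (Fin n)), Ω z⟫ ^ 2 - 1 / n)) y) x) •
            (h ⟪(u : EuclideanSpace ℝ (Fin n)), w⟫ •
              projPerp w (u : EuclideanSpace ℝ (Fin n)))
      = A u • projPerp w (u : EuclideanSpace ℝ (Fin n))
        + (g1 ⟪(u : EuclideanSpace ℝ (Fin n)), w⟫ * ⟪(u : EuclideanSpace ℝ (Fin n)), W⟫) •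
          projPerp w (u : EuclideanSpace ℝ (Fin n))
        + (g2 ⟪(u : EuclideanSpace ℝ (Fin n)), w⟫ *
            ⟪(u : EuclideanSpace ℝ (Fin n)), projPerp w L⟫) •
          projPerp w (u : EuclideanSpace ℝ (Fin n)) := by
    intro u
    rw [smul_smul, ← add_smul, ← add_smul]
    congr 1
    rw [Finset.sum_congr rfl fun j _ => div_term hinv hρ hΩdiff hΩ hη x u j
      ⟪(u : EuclideanSpace ℝ (Fin n)), w⟫ ⟪(u : EuclideanSpace ℝ (Fin n)), o j⟫
      ⟪(u : EuclideanSpace ℝ (Fin n)), o2 j⟫ (R j) (R2 j)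
      (γ ⟪(u : EuclideanSpace ℝ (Fin n)), w⟫) e e1 e2 d (by rw [hw]) (by rw [ho])
      (by rw [ho2]) (hR j) (hR2 j) (by rw [← hγG, he, hw]) he he1 he2 hd]
    rw [hW, hL, projPerp, inner_sub_right, real_inner_smul_right, inner_sum, inner_sum, sum_inner,
      hA, hg1, hg2]
    simp only [real_inner_smul_right]
    rw [← hr, Finset.sum_mul, Finset.sum_mul, ← Finset.sum_sub_distrib, Finset.mul_sum,
      Finset.mul_sum, Finset.mul_sum, ← Finset.sum_add_distrib, ← Finset.sum_add_distrib]
    refine Finset.sum_congr rfl fun j _ => ?_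
    ring
  have hI1 : Integrable (fun u : sphere (0 : EuclideanSpace ℝ (Fin n)) 1 =>
      A u • projPerp w (u : EuclideanSpace ℝ (Fin n))) σ :=
    integrable_of_cont σ (hAc.smul hPc)
  have hI2 : Integrable (fun u : sphere (0 : EuclideanSpace ℝ (Fin n)) 1 =>
      (g1 ⟪(u : EuclideanSpace ℝ (Fin n)), w⟫ * ⟪(u : EuclideanSpace ℝ (Fin n)), W⟫) •
          projPerp w (u : EuclideanSpace ℝ (Fin n))) σ :=
    integrable_of_cont σ ((hg1c.mul (by fun_prop)).smul hPc)
  have hI3 : Integrable (fun u : sphere (0 : EuclideanSpace ℝ (Fin n)) 1 =>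
      (g2 ⟪(u : EuclideanSpace ℝ (Fin n)), w⟫ *
            ⟪(u : EuclideanSpace ℝ (Fin n)), projPerp w L⟫) •
          projPerp w (u : EuclideanSpace ℝ (Fin n))) σ :=
    integrable_of_cont σ ((hg2c.mul (by fun_prop)).smul hPc)
  have hI12 : Integrable (fun u : sphere (0 : EuclideanSpace ℝ (Fin n)) 1 =>
      A u • projPerp w (u : EuclideanSpace ℝ (Fin n)) +
      (g1 ⟪(u : EuclideanSpace ℝ (Fin n)), w⟫ * ⟪(u : EuclideanSpace ℝ (Fin n)), W⟫) •
          projPerp w (u : EuclideanSpace ℝ (Fin n))) σ := hI1.add hI2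
  simp only [hpt]
  rw [integral_add hI12 hI3, integral_add hI1 hI2, even_vanish hinv w hw1 A, zero_add,
    odd_val hn hinv w hw1 g1 hg1c W hWw,
    odd_val hn hinv w hw1 g2 hg2c (projPerp w L) (projPerp_inner_self w L hw1)]
  · have hck : ∀ k, Integrable (fun u : sphere (0 : EuclideanSpace ℝ (Fin n)) 1 =>
        ⟪(u : EuclideanSpace ℝ (Fin n)), w⟫ ^ k *
        h ⟪(u : EuclideanSpace ℝ (Fin n)), w⟫ *
        (1 - ⟪(u : EuclideanSpace ℝ (Fin n)), w⟫ ^ 2) *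
        γ ⟪(u : EuclideanSpace ℝ (Fin n)), w⟫) σ := fun k =>
      integrable_of_cont σ ((((Continuous.mul (by fun_prop) hhc)).mul (by fun_prop)).mul
        (by fun_prop))
    have hi2 : ∫ u : sphere (0 : EuclideanSpace ℝ (Fin n)) 1,
        g2 ⟪(u : EuclideanSpace ℝ (Fin n)), w⟫ *
          (1 - ⟪(u : EuclideanSpace ℝ (Fin n)), w⟫ ^ 2) ∂σ
        = 2 * e * r * cCoeff σ h e w 1 := by
      simp only [cCoeff, hγG]
      rw [← integral_const_mul]
      refine integral_congr_ae (Filter.Eventually.of_forall fun u => ?_)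
      simp only [hg2]
      ring
    have hi1 : ∫ u : sphere (0 : EuclideanSpace ℝ (Fin n)) 1,
        g1 ⟪(u : EuclideanSpace ℝ (Fin n)), w⟫ *
          (1 - ⟪(u : EuclideanSpace ℝ (Fin n)), w⟫ ^ 2) ∂σ
        = 2 * (2 * e1 * r + e + r * e * e1 * (- 1 / n - d)) * cCoeff σ h e w 1
          + 4 * (r * e * e1) * cCoeff σ h e w 3 := by
      simp only [cCoeff, hγG]
      rw [← integral_const_mul, ← integral_const_mul,
        ← integral_add ((hck 1).const_mul _) ((hck 3).const_mul _)]
      refine integral_congr_ae (Filter.Eventually.of_forall fun u => ?_)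
      simp only [hg1]
      ring
    rw [hi1, hi2]
    congr 2
    ring
  · intro u v h1 h2
    simp only [hA, h1, h2 _ (how _), neg_sq]
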